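/- Let X_t be the symmetric decoherent Hadamard walk on the line with 0 < p ≤ 1 and q = 1 − p. Then there exist constants c > 0 and C > 0 such that for all t, |Var(X_t) − [((p + 2√(1+q²) − 2)/p)·t − 2q²/(p√(1+q²)) − (2/p²)(1 + q² − √(1+q²))]| ≤ C·e^{−ct}. -/

import Mathlib

noncomputable section

open Complex Filter

/-- Amplitude functions on the position × coin space `ℤ × {1,2}`
(coin `0` = "right", coin `1` = "left"). -/
abbrev QState := ℤ × Fin 2 → ℂ

/-- One step of the Hadamard walk: `(hadamardStep ψ) (x,n) = ⟨x,n|U ψ⟩`, where `U = S ∘ C`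
with `S` the chirality-conditioned shift and `C` the Hadamard coin. -/
def hadamardStep (ψ : QState) : QState := fun v =>
  if v.2 = 0 then (ψ (v.1 - 1, 0) + ψ (v.1 - 1, 1)) / (Real.sqrt 2 : ℂ)
  else (ψ (v.1 + 1, 0) - ψ (v.1 + 1, 1)) / (Real.sqrt 2 : ℂ)

/-- The basis state `|x,n⟩`. -/
def ket (x : ℤ) (n : Fin 2) : QState := fun v => if v = (x, n) then 1 else 0

/-- Pure Hadamard-walk probabilities `W_{m,n}(x,t) = |⟨x,n|U^t|0,m⟩|²`. -/
def W (m n : Fin 2) (x : ℤ) (t : ℕ) : ℝ := ‖(hadamardStep^[t] (ket 0 m)) (x, n)‖ ^ 2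

/-- Measurement operators, indexed by `𝔸 = {c} ∪ ℤ×{1,2}`:
`none` is the coherent projection `A_c = √(1-p)·I`, and `some (x,n)` is the
decoherence projection `A_{x,n} = √p |x,n⟩⟨x,n|`. -/
def measOp (p : ℝ) : Option (ℤ × Fin 2) → QState → QState
  | none => fun ψ v => (Real.sqrt (1 - p) : ℂ) * ψ v
  | some w => fun ψ v => if v = w then (Real.sqrt p : ℂ) * ψ w else 0

/-- The amplitude `(A_{j_t}U)⋯(A_{j_1}U)|0,m⟩` along the path `j`. -/
def pathAmp (p : ℝ) (m : Fin 2) : (t : ℕ) → (Fin t → Option (ℤ × Fin 2)) → QState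
  | 0, _ => ket 0 m
  | t + 1, j => measOp p (j (Fin.last t)) (hadamardStep (pathAmp p m t fun i => j i.castSucc))

/-- Decoherent Hadamard-walk probabilities
`P_{m,n}(x,t) = Σ_{j∈𝔸^t} |⟨x,n|(A_{j_t}U)⋯(A_{j_1}U)|0,m⟩|²`. -/
def Pdec (p : ℝ) (m n : Fin 2) (x : ℤ) (t : ℕ) : ℝ :=
  ∑' j : Fin t → Option (ℤ × Fin 2), ‖pathAmp p m t j (x, n)‖ ^ 2

/-- `Ŵ_{m,n}(k,t) = Σ_x W_{m,n}(x,t) e^{ikx}`. -/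
def What (m n : Fin 2) (k : ℝ) (t : ℕ) : ℂ :=
  ∑' x : ℤ, (W m n x t : ℂ) * Complex.exp (Complex.I * k * x)

/-- `P̂_{m,n}(k,z) = Σ_{t≥0} Σ_x P_{m,n}(x,t) e^{ikx} z^t`. -/
def Phat (p : ℝ) (m n : Fin 2) (k : ℝ) (z : ℂ) : ℂ :=
  ∑' t : ℕ, (∑' x : ℤ, (Pdec p m n x t : ℂ) * Complex.exp (Complex.I * k * x)) * z ^ t

/-- `Q̂_{m,n}(k,z) = (p/q) Σ_{t≥1} Ŵ_{m,n}(k,t) (qz)^t = p Σ_{t≥1} Ŵ_{m,n}(k,t) q^{t-1} z^t`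
with `q = 1-p`. -/
def Qhat (p : ℝ) (m n : Fin 2) (k : ℝ) (z : ℂ) : ℂ :=
  (p : ℂ) * ∑' t : ℕ, What m n k (t + 1) * ((1 - p : ℝ) : ℂ) ^ t * z ^ (t + 1)

/-- The matrix `P(k,z) = (P̂_{m,n}(k,z))`. -/
def Pmat (p k : ℝ) (z : ℂ) : Matrix (Fin 2) (Fin 2) ℂ := Matrix.of fun m n => Phat p m n k z

/-- The matrix `Q(k,z) = (Q̂_{m,n}(k,z))`. -/
def Qmat (p k : ℝ) (z : ℂ) : Matrix (Fin 2) (Fin 2) ℂ := Matrix.of fun m n => Qhat p m n k z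

/-- Maximum row-sum norm of a 2×2 complex matrix. -/
def rowSumNorm (A : Matrix (Fin 2) (Fin 2) ℂ) : ℝ :=
  max (‖A 0 0‖ + ‖A 0 1‖) (‖A 1 0‖ + ‖A 1 1‖)

/-- Distribution of the symmetric decoherent Hadamard walk:
`P(X_t = x) = (1/2) Σ_{m,n} P_{m,n}(x,t)`. -/
def PsymProb (p : ℝ) (x : ℤ) (t : ℕ) : ℝ := (1/2) * ∑ m : Fin 2, ∑ n : Fin 2, Pdec p m n x t

/-- Mean position of the symmetric decoherent walk. -/
def symMean (p : ℝ) (t : ℕ) : ℝ := ∑' x : ℤ, (x : ℝ) * PsymProb p x t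

/-- Variance of the symmetric decoherent walk. -/
def symVar (p : ℝ) (t : ℕ) : ℝ :=
  (∑' x : ℤ, (x : ℝ) ^ 2 * PsymProb p x t) - (∑' x : ℤ, (x : ℝ) * PsymProb p x t) ^ 2

/-- The symmetric generating function `P̂(k,z) = (1/2) Σ_{m,n} P̂_{m,n}(k,z)`. -/
def PhatSym (p k : ℝ) (z : ℂ) : ℂ := (1/2) * ∑ m : Fin 2, ∑ n : Fin 2, Phat p m n k z

/-- Characteristic function `P̂(k,t)` of the symmetric decoherent walk. -/
def charSym (p k : ℝ) (t : ℕ) : ℂ :=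
  ∑' x : ℤ, (PsymProb p x t : ℂ) * Complex.exp (Complex.I * k * x)

/-- Distribution of the decoherent walk started at `|0,1⟩`: `P(X̃_t = x) = Σ_n P_{1,n}(x,t)`. -/
def Ptilde (p : ℝ) (x : ℤ) (t : ℕ) : ℝ := ∑ n : Fin 2, Pdec p 0 n x t

/-- Mean position of the decoherent walk started at `|0,1⟩`. -/
def tildeMean (p : ℝ) (t : ℕ) : ℝ := ∑' x : ℤ, (x : ℝ) * Ptilde p x t

/-- Variance of the decoherent walk started at `|0,1⟩`. -/
def tildeVar (p : ℝ) (t : ℕ) : ℝ :=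
  (∑' x : ℤ, (x : ℝ) ^ 2 * Ptilde p x t) - (∑' x : ℤ, (x : ℝ) * Ptilde p x t) ^ 2

/-- Characteristic function of the decoherent walk started at `|0,1⟩`. -/
def charTilde (p k : ℝ) (t : ℕ) : ℂ :=
  ∑' x : ℤ, (Ptilde p x t : ℂ) * Complex.exp (Complex.I * k * x)

/-- The symmetric initial state `φ₀ = (|0,1⟩ + i|0,2⟩)/√2`. -/
def phi0 : QState := fun v =>
  if v = ((0 : ℤ), (0 : Fin 2)) then (1 / Real.sqrt 2 : ℂ)
  else if v = ((0 : ℤ), (1 : Fin 2)) then Complex.I / Real.sqrt 2 else 0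

/-- Distribution of the pure symmetric Hadamard walk: `P(Q_t = x) = Σ_n |⟨x,n|U^t|φ₀⟩|²`. -/
def Ppure (x : ℤ) (t : ℕ) : ℝ := ∑ n : Fin 2, ‖(hadamardStep^[t] phi0) (x, n)‖ ^ 2

/-- Variance of the pure symmetric Hadamard walk. -/
def pureVar (t : ℕ) : ℝ :=
  (∑' x : ℤ, (x : ℝ) ^ 2 * Ppure x t) - (∑' x : ℤ, (x : ℝ) * Ppure x t) ^ 2

/-- `E(k,z) = √((q²z² − (1+cos k)qz + 1)(q²z² + (1+cos k)qz + 1))`, principal branch. -/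
def Efun (q k : ℝ) (z : ℂ) : ℂ :=
  (((q : ℂ) ^ 2 * z ^ 2 - (1 + (Real.cos k : ℂ)) * (q : ℂ) * z + 1) *
    ((q : ℂ) ^ 2 * z ^ 2 + (1 + (Real.cos k : ℂ)) * (q : ℂ) * z + 1)) ^ ((1 : ℂ) / 2)

/-- The displacement of the shift: `+1` for coin `0` and `-1` for coin `1`. -/
def coinStep (c : Fin 2) : ℤ := if c = 0 then 1 else -1

/-- The entries of `√2 • C` for the Hadamard coin `C`. -/
def hadamardSign (c a : Fin 2) : ℝ := if c = 1 ∧ a = 1 then -1 else 1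

/-- Real kernels on the position × coin space, i.e. matrices of observables. -/
abbrev Kernel2 := ℤ × Fin 2 → ℤ × Fin 2 → ℝ

/-- The measurement superoperator multiplies off-diagonal entries by `1 - p`. -/
def dampFactor (p : ℝ) (v w : ℤ × Fin 2) : ℝ := if v = w then 1 else 1 - p

/-- One step of the decoherent walk in the Heisenberg picture. -/
def heisenberg (p : ℝ) : Kernel2 →L[ℝ] Kernel2 where
  toFun A v w := ∑ c : Fin 2, ∑ e : Fin 2, hadamardSign c v.2 * hadamardSign e w.2 / 2 *
    (dampFactor p (v.1 + coinStep c, c) (w.1 + coinStep e, e) *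
      A (v.1 + coinStep c, c) (w.1 + coinStep e, e))
  map_add' A B := by
    funext v w
    simp only [Pi.add_apply, ← Finset.sum_add_distrib]
    exact Finset.sum_congr rfl fun c _ => Finset.sum_congr rfl fun e _ => by ring
  map_smul' r A := by
    funext v w
    simp only [Pi.smul_apply, smul_eq_mul, Finset.mul_sum, RingHom.id_apply]
    exact Finset.sum_congr rfl fun c _ => Finset.sum_congr rfl fun e _ => by ring
  cont := by fun_prop

/-- The matrix unit at `(v, w)`. -/
def matrixUnit (v w : ℤ × Fin 2) : Kernel2 := fun v' w' => if v' = v ∧ w' = w then 1 else 0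

/-- Expectation of the observable `A` after `t` steps, from the mixed initial state
`(|0,1⟩⟨0,1| + |0,2⟩⟨0,2|)/2`. -/
def expect (p : ℝ) (t : ℕ) (A : Kernel2) : ℝ :=
  1 / 2 * ∑ m : Fin 2, (heisenberg p ^ t) A (0, m) (0, m)

theorem expect_succ (p : ℝ) (t : ℕ) (A : Kernel2) :
    expect p (t + 1) A = expect p t (heisenberg p A) := by
  simp only [expect, pow_succ]
  rfl

theorem expect_add (p : ℝ) (t : ℕ) (A B : Kernel2) :
    expect p t (A + B) = expect p t A + expect p t B := by
  simp only [expect, map_add, Pi.add_apply, Finset.sum_add_distrib, mul_add]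

theorem expect_smul (p r : ℝ) (t : ℕ) (A : Kernel2) :
    expect p t (r • A) = r * expect p t A := by
  simp only [expect, map_smul, Pi.smul_apply, smul_eq_mul, Fin.sum_univ_two]
  ring

theorem heisenberg_matrixUnit (p : ℝ) (v w : ℤ × Fin 2) :
    heisenberg p (matrixUnit v w) = ∑ a : Fin 2, ∑ b : Fin 2,
      (dampFactor p v w * (hadamardSign v.2 a * hadamardSign w.2 b / 2)) •
        matrixUnit (v.1 - coinStep v.2, a) (w.1 - coinStep w.2, b) := by
  funext ⟨x, a⟩ ⟨y, b⟩
  obtain ⟨x', c⟩ := v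
  obtain ⟨y', e⟩ := w
  have hx : ∀ s : ℤ, x = x' - s ↔ x + s = x' := fun s => by omega
  have hy : ∀ s : ℤ, y = y' - s ↔ y + s = y' := fun s => by omega
  have key : ∀ (c' e' : Fin 2), dampFactor p (x + coinStep c', c') (y + coinStep e', e') *
      matrixUnit (x', c) (y', e) (x + coinStep c', c') (y + coinStep e', e') =
      dampFactor p (x', c) (y', e) *
        if (x + coinStep c' = x' ∧ c' = c) ∧ (y + coinStep e' = y' ∧ e' = e) then 1 else 0 := by
    intro c' e'
    simp only [matrixUnit, Prod.mk.injEq]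
    split_ifs with h
    · obtain ⟨⟨rfl, rfl⟩, rfl, rfl⟩ := h
      rfl
    · simp
  change ∑ c' : Fin 2, ∑ e' : Fin 2, hadamardSign c' a * hadamardSign e' b / 2 *
    (dampFactor p (x + coinStep c', c') (y + coinStep e', e') *
      matrixUnit (x', c) (y', e) (x + coinStep c', c') (y + coinStep e', e')) = _
  simp only [key]
  simp only [Fin.sum_univ_two, Pi.add_apply, Pi.smul_apply, matrixUnit, Prod.mk.injEq, hx, hy,
    smul_eq_mul]
  fin_cases a <;> fin_cases b <;> fin_cases c <;> fin_cases e <;> simp <;> split_ifs <;> ring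

theorem hadamardStep_apply (ψ : QState) (v : ℤ × Fin 2) :
    hadamardStep ψ v = ∑ a : Fin 2,
      (hadamardSign v.2 a : ℂ) / (Real.sqrt 2 : ℂ) * ψ (v.1 - coinStep v.2, a) := by
  obtain ⟨x, c⟩ := v
  fin_cases c <;> simp [hadamardStep, hadamardSign, coinStep] <;> ring

theorem hadamardStep_mul_conj (ψ : QState) (v w : ℤ × Fin 2) :
    hadamardStep ψ v * (starRingEnd ℂ) (hadamardStep ψ w) = ∑ a : Fin 2, ∑ b : Fin 2,
      ((hadamardSign v.2 a * hadamardSign w.2 b / 2 : ℝ) : ℂ) *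
        (ψ (v.1 - coinStep v.2, a) * (starRingEnd ℂ) (ψ (w.1 - coinStep w.2, b))) := by
  have h2 : (Real.sqrt 2 : ℂ) * (Real.sqrt 2 : ℂ) = 2 := by
    rw [← Complex.ofReal_mul, Real.mul_self_sqrt (by norm_num)]
    norm_num
  simp only [hadamardStep_apply, map_sum, Finset.sum_mul_sum, map_mul, map_div₀,
    Complex.conj_ofReal]
  refine Finset.sum_congr rfl fun a _ => Finset.sum_congr rfl fun b _ => ?_
  push_cast
  rw [← h2]
  ring

theorem sum_measOp_mul_conj {p : ℝ} (hp0 : 0 ≤ p) (hp1 : p ≤ 1) (φ : QState)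
    (v w : ℤ × Fin 2) :
    ∑ o ∈ {none, some v}, measOp p o φ v * (starRingEnd ℂ) (measOp p o φ w) =
      (dampFactor p v w : ℂ) * (φ v * (starRingEnd ℂ) (φ w)) := by
  have hs : ∀ r : ℝ, 0 ≤ r → (Real.sqrt r : ℂ) * (Real.sqrt r : ℂ) = r := fun r hr => by
    rw [← Complex.ofReal_mul, Real.mul_self_sqrt hr]
  have h1 := hs p hp0
  have h2 := hs (1 - p) (by linarith)
  rw [Finset.sum_pair (by simp)]
  rcases eq_or_ne v w with rfl | h
  · simp only [measOp, if_true, dampFactor, map_mul, Complex.conj_ofReal]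
    push_cast at h2 ⊢
    linear_combination (φ v * (starRingEnd ℂ) (φ v)) * (h1 + h2)
  · simp only [measOp, if_true, dampFactor, if_neg h, if_neg h.symm, map_mul,
      Complex.conj_ofReal]
    push_cast at h2 ⊢
    simp
    linear_combination (φ v * (starRingEnd ℂ) (φ w)) * h2

theorem summable_prod_of_finset_slices {α β : Type*} [DecidableEq α] (f : α × β → ℂ)
    (s : Finset α) (hf : ∀ j, j.1 ∉ s → f j = 0) (hsum : ∀ a, Summable fun b => f (a, b)) :
    Summable f := by
  have hdec : f = fun j => ∑ a ∈ s, if j.1 = a then f (a, j.2) else 0 := by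
    funext j
    by_cases hj : j.1 ∈ s
    · rw [Finset.sum_ite_eq, if_pos hj]
    · rw [Finset.sum_ite_eq, if_neg hj, hf j hj]
  rw [hdec]
  refine summable_sum fun a _ => ?_
  have hinj : Function.Injective fun b : β => (a, b) := fun b c h => (Prod.mk.inj h).2
  refine (hinj.summable_iff ?_).1 ?_
  · rintro ⟨a', b⟩ hb
    refine if_neg ?_
    rintro rfl
    exact hb ⟨b, rfl⟩
  · simpa [Function.comp_def] using hsum a

theorem hasSum_pathAmp_mul_conj {p : ℝ} (hp0 : 0 ≤ p) (hp1 : p ≤ 1) (m : Fin 2) (t : ℕ) :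
    ∀ v w : ℤ × Fin 2, HasSum (fun j : Fin t → Option (ℤ × Fin 2) =>
      pathAmp p m t j v * (starRingEnd ℂ) (pathAmp p m t j w))
      (((heisenberg p ^ t) (matrixUnit v w) (0, m) (0, m) : ℝ) : ℂ) := by
  induction t with
  | zero =>
    intro v w
    have h := hasSum_unique fun j : Fin 0 → Option (ℤ × Fin 2) =>
      pathAmp p m 0 j v * (starRingEnd ℂ) (pathAmp p m 0 j w)
    convert h using 1
    simp only [pow_zero, one_apply_eq_self, matrixUnit, pathAmp, ket,
      eq_comm (a := ((0 : ℤ), m))]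
    by_cases hv : v = (0, m) <;> by_cases hw : w = (0, m) <;> simp [hv, hw]
  | succ t ih =>
    intro v w
    set φ : (Fin t → Option (ℤ × Fin 2)) → QState := fun j => hadamardStep (pathAmp p m t j)
      with hφ
    set S : ℝ := ∑ a : Fin 2, ∑ b : Fin 2, (hadamardSign v.2 a * hadamardSign w.2 b / 2) *
      (heisenberg p ^ t) (matrixUnit (v.1 - coinStep v.2, a) (w.1 - coinStep w.2, b))
        (0, m) (0, m) with hS
    have hstep : HasSum (fun j => φ j v * (starRingEnd ℂ) (φ j w)) (S : ℂ) := by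
      simp only [hφ, hadamardStep_mul_conj, hS]
      push_cast
      refine hasSum_sum fun a _ => hasSum_sum fun b _ => ?_
      have := (ih (v.1 - coinStep v.2, a) (w.1 - coinStep w.2, b)).mul_left
        ((hadamardSign v.2 a * hadamardSign w.2 b / 2 : ℝ) : ℂ)
      push_cast at this
      exact this
    have hval : (heisenberg p ^ (t + 1)) (matrixUnit v w) (0, m) (0, m) =
        dampFactor p v w * S := by
      change (heisenberg p ^ t) (heisenberg p (matrixUnit v w)) (0, m) (0, m) = _
      rw [heisenberg_matrixUnit]
      simp only [map_sum, map_smul, Finset.sum_apply, Pi.smul_apply, smul_eq_mul, hS,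
        Finset.mul_sum, mul_assoc]
    rw [hval, ← (Fin.snocEquiv fun _ => Option (ℤ × Fin 2)).hasSum_iff]
    have hslice : (fun j : Fin (t + 1) → Option (ℤ × Fin 2) =>
        pathAmp p m (t + 1) j v * (starRingEnd ℂ) (pathAmp p m (t + 1) j w)) ∘
          (Fin.snocEquiv fun _ => Option (ℤ × Fin 2)) =
        fun j => measOp p j.1 (φ j.2) v * (starRingEnd ℂ) (measOp p j.1 (φ j.2) w) := by
      funext j
      simp [pathAmp, hφ]
    rw [hslice]
    have hslices : ∀ o, Summable fun j' =>
        measOp p o (φ j') v * (starRingEnd ℂ) (measOp p o (φ j') w) := by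
      intro o
      rcases o with _ | u
      · have := hstep.summable.mul_left
          ((Real.sqrt (1 - p) : ℂ) * (Real.sqrt (1 - p) : ℂ))
        refine this.congr fun j' => ?_
        simp only [measOp, map_mul, Complex.conj_ofReal]
        ring
      · by_cases h : v = u ∧ w = u
        · obtain ⟨rfl, rfl⟩ := h
          have := hstep.summable.mul_left ((Real.sqrt p : ℂ) * (Real.sqrt p : ℂ))
          refine this.congr fun j' => ?_
          simp only [measOp, if_true, map_mul, Complex.conj_ofReal]
          ring
        · refine summable_zero.congr fun j' => ?_
          rw [not_and_or] at h
          rcases h with h | h <;> simp [measOp, h]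
    have hzero : ∀ j : Option (ℤ × Fin 2) × (Fin t → Option (ℤ × Fin 2)),
        j.1 ∉ ({none, some v} : Finset _) →
        measOp p j.1 (φ j.2) v * (starRingEnd ℂ) (measOp p j.1 (φ j.2) w) = 0 := by
      rintro ⟨_ | u, j'⟩ hj
      · simp at hj
      · have : v ≠ u := by
          rintro rfl
          simp at hj
        simp [measOp, this]
    have hsum := summable_prod_of_finset_slices _ _ hzero hslices
    convert hsum.hasSum using 1
    refine Eq.trans ?_
      (hsum.prod_symm.tsum_prod.symm.trans ((Equiv.prodComm _ _).tsum_eq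
        fun j => measOp p j.1 (φ j.2) v * (starRingEnd ℂ) (measOp p j.1 (φ j.2) w)))
    have : ∀ j', ∑' o, measOp p o (φ j') v * (starRingEnd ℂ) (measOp p o (φ j') w) =
        (dampFactor p v w : ℂ) * (φ j' v * (starRingEnd ℂ) (φ j' w)) := fun j' => by
      rw [← sum_measOp_mul_conj hp0 hp1]
      exact tsum_eq_sum fun o ho => hzero (o, j') ho
    simp only [Prod.swap_prod_mk, this]
    rw [tsum_mul_left, hstep.tsum_eq]
    push_cast
    rfl

theorem Pdec_eq {p : ℝ} (hp0 : 0 ≤ p) (hp1 : p ≤ 1) (m n : Fin 2) (x : ℤ) (t : ℕ) :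
    Pdec p m n x t = (heisenberg p ^ t) (matrixUnit (x, n) (x, n)) (0, m) (0, m) := by
  have h := hasSum_pathAmp_mul_conj hp0 hp1 m t (x, n) (x, n)
  simp only [Complex.mul_conj, Complex.normSq_eq_norm_sq] at h
  exact (Complex.hasSum_ofReal.1 h).tsum_eq

theorem PsymProb_eq {p : ℝ} (hp0 : 0 ≤ p) (hp1 : p ≤ 1) (x : ℤ) (t : ℕ) :
    PsymProb p x t = expect p t (∑ n : Fin 2, matrixUnit (x, n) (x, n)) := by
  simp only [PsymProb, expect, Pdec_eq hp0 hp1, map_sum, Finset.sum_apply]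

/-- Multiplication by a function of the position. -/
def positionKernel (f : ℤ → ℝ) : Kernel2 := fun v w => if v = w then f v.1 else 0

theorem hasSum_positionKernel (f : ℤ → ℝ) :
    HasSum (fun x : ℤ => f x • ∑ n : Fin 2, matrixUnit (x, n) (x, n)) (positionKernel f) := by
  refine Pi.hasSum.2 fun v => Pi.hasSum.2 fun w => ?_
  convert hasSum_single v.1 fun x hx => ?_ using 1
  · obtain ⟨x, a⟩ := v
    obtain ⟨y, b⟩ := w
    fin_cases a <;> fin_cases b <;>
      simp [positionKernel, matrixUnit, Fin.sum_univ_two, eq_comm (a := y)]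
  · simp [matrixUnit, Fin.sum_univ_two, Prod.ext_iff, hx.symm]

theorem tsum_mul_PsymProb {p : ℝ} (hp0 : 0 ≤ p) (hp1 : p ≤ 1) (f : ℤ → ℝ) (t : ℕ) :
    ∑' x : ℤ, f x * PsymProb p x t = expect p t (positionKernel f) := by
  have h := (heisenberg p ^ t).hasSum (hasSum_positionKernel f)
  have h' := fun m : Fin 2 => Pi.hasSum.1 (Pi.hasSum.1 h (0, m)) (0, m)
  have h'' := (hasSum_sum fun (m : Fin 2) (_ : m ∈ Finset.univ) => h' m).mul_left (1 / 2)
  simp only [PsymProb_eq hp0 hp1, ← expect_smul]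
  exact h''.tsum_eq

theorem heisenberg_apply (p : ℝ) (A : Kernel2) (v w : ℤ × Fin 2) :
    heisenberg p A v w = ∑ c : Fin 2, ∑ e : Fin 2,
      hadamardSign c v.2 * hadamardSign e w.2 / 2 *
        (dampFactor p (v.1 + coinStep c, c) (w.1 + coinStep e, e) *
          A (v.1 + coinStep c, c) (w.1 + coinStep e, e)) :=
  rfl

/-- Pairs of sequences indexed by position differences; `(f, g)` encodes the translation-invariant
traceless kernel with diagonal coin entries `f, -f` and off-diagonal coin entries `g`. -/
abbrev BlochSeq := (ℤ → ℝ) × (ℤ → ℝ)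

/-- The translation-invariant kernel encoded by a pair of sequences. -/
def blochKernel (s : BlochSeq) : Kernel2 := fun v w =>
  if v.2 = w.2 then (if v.2 = 0 then s.1 (v.1 - w.1) else -s.1 (v.1 - w.1))
  else if v.2 = 0 then s.2 (v.1 - w.1) else s.2 (w.1 - v.1)

/-- The anticommutator of the position with a translation-invariant traceless kernel. -/
def positionBlochKernel (s : BlochSeq) : Kernel2 := fun v w => (v.1 + w.1) * blochKernel s v w

/-- The translation-invariant kernel acting trivially on the coin. -/
def scalarKernel (h : ℤ → ℝ) : Kernel2 := fun v w => if v.2 = w.2 then h (v.1 - w.1) else 0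

/-- Conjugation by the unitary Hadamard step. -/
def blochRotate : BlochSeq →ₗ[ℝ] BlochSeq where
  toFun s := (fun d => (s.2 (2 + d) + s.2 (2 - d)) / 2,
    fun d => s.1 d + (s.2 (2 - d) - s.2 (2 + d)) / 2)
  map_add' s r := by
    ext d <;> simp <;> ring
  map_smul' a s := by
    ext d <;> simp <;> ring

theorem blochRotate_apply (s : BlochSeq) : blochRotate s =
    (fun d => (s.2 (2 + d) + s.2 (2 - d)) / 2,
      fun d => s.1 d + (s.2 (2 - d) - s.2 (2 + d)) / 2) :=
  rfl

/-- The pair of sequences encoding the Pauli matrix `σ_z`. -/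
def blochZ : BlochSeq := (Pi.single 0 1, 0)

/-- The effect of the measurement superoperator. -/
def blochDamp (p : ℝ) (s : BlochSeq) : BlochSeq := (1 - p) • s + (p * s.1 0) • blochZ

theorem blochRotate_even (s : BlochSeq) (d : ℤ) :
    (blochRotate s).1 (-d) = (blochRotate s).1 d := by
  simp only [blochRotate_apply, sub_neg_eq_add, ← sub_eq_add_neg]
  ring

theorem blochRotate_blochZ : blochRotate blochZ = (0, Pi.single 0 1) := by
  ext d <;> simp [blochRotate, blochZ]

theorem heisenberg_blochKernel (p : ℝ) (s : BlochSeq) (hs : ∀ d, s.1 (-d) = s.1 d) :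
    heisenberg p (blochKernel s) = blochKernel (blochRotate (blochDamp p s)) := by
  funext ⟨x, a⟩ ⟨y, b⟩
  have h1 : x + 1 - (y + -1) = 2 + (x - y) := by ring
  have h4 : y + 1 - (x + -1) = 2 - (x - y) := by ring
  have h5 : y - x = -(x - y) := by ring
  have h7 : 2 + -(x - y) = 2 - (x - y) := by ring
  have h8 : 2 - -(x - y) = 2 + (x - y) := by ring
  have hs' := hs (x - y)
  rw [heisenberg_apply]
  rcases eq_or_ne x y with rfl | hxy
  · fin_cases a <;> fin_cases b <;>
      simp [Fin.sum_univ_two, blochKernel, dampFactor, coinStep, hadamardSign, blochRotate,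
        blochDamp, blochZ] <;> ring
  · have hd : x - y ≠ 0 := sub_ne_zero.2 hxy
    fin_cases a <;> fin_cases b <;>
      simp [Fin.sum_univ_two, blochKernel, dampFactor, coinStep, hadamardSign, blochRotate,
        blochDamp, blochZ, h1, h4, h5, h7, h8, hxy, hd, hs', -neg_sub] <;> ring

theorem heisenberg_positionBlochKernel (p : ℝ) (s : BlochSeq) (hs : ∀ d, s.1 (-d) = s.1 d) :
    heisenberg p (positionBlochKernel s) =
      positionBlochKernel (blochRotate (blochDamp p s)) +
        (2 : ℝ) • scalarKernel (blochDamp p s).1 := by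
  funext ⟨x, a⟩ ⟨y, b⟩
  simp only [Pi.add_apply, positionBlochKernel, ← heisenberg_blochKernel p s hs]
  simp only [heisenberg_apply, positionBlochKernel]
  rcases eq_or_ne x y with rfl | hxy
  · fin_cases a <;> fin_cases b <;>
      simp [Fin.sum_univ_two, blochKernel, dampFactor, coinStep, hadamardSign,
        blochDamp, blochZ, scalarKernel] <;> ring
  · have hd : x - y ≠ 0 := sub_ne_zero.2 hxy
    fin_cases a <;> fin_cases b <;>
      simp [Fin.sum_univ_two, blochKernel, dampFactor, coinStep, hadamardSign,
        blochDamp, blochZ, scalarKernel, hxy, hd] <;> ring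

theorem heisenberg_scalarKernel (p : ℝ) (h : ℤ → ℝ) :
    heisenberg p (scalarKernel h) =
      scalarKernel ((1 - p) • h + (p * h 0) • Pi.single 0 1) := by
  funext ⟨x, a⟩ ⟨y, b⟩
  rw [heisenberg_apply]
  rcases eq_or_ne x y with rfl | hxy
  · fin_cases a <;> fin_cases b <;>
      simp [Fin.sum_univ_two, dampFactor, coinStep, hadamardSign, scalarKernel] <;> ring
  · have hd : x - y ≠ 0 := sub_ne_zero.2 hxy
    fin_cases a <;> fin_cases b <;>
      simp [Fin.sum_univ_two, dampFactor, coinStep, hadamardSign, scalarKernel, hxy, hd] <;> ring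

theorem heisenberg_positionKernel_id (p : ℝ) :
    heisenberg p (positionKernel fun x => x) =
      positionKernel (fun x => x) + blochKernel (blochRotate blochZ) := by
  funext ⟨x, a⟩ ⟨y, b⟩
  rw [blochRotate_blochZ, heisenberg_apply]
  rcases eq_or_ne x y with rfl | hxy
  · fin_cases a <;> fin_cases b <;>
      simp [Fin.sum_univ_two, dampFactor, coinStep, hadamardSign, positionKernel,
        blochKernel] <;> ring
  · have hd : x - y ≠ 0 := sub_ne_zero.2 hxy
    have hd' : y - x ≠ 0 := sub_ne_zero.2 hxy.symm
    fin_cases a <;> fin_cases b <;>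
      simp [Fin.sum_univ_two, dampFactor, coinStep, hadamardSign, positionKernel,
        blochKernel, hxy, hd, hd']

theorem heisenberg_positionKernel_sq (p : ℝ) :
    heisenberg p (positionKernel fun x => (x : ℝ) ^ 2) =
      positionKernel (fun x => (x : ℝ) ^ 2) + scalarKernel (Pi.single 0 1) +
        positionBlochKernel (blochRotate blochZ) := by
  funext ⟨x, a⟩ ⟨y, b⟩
  rw [blochRotate_blochZ, heisenberg_apply]
  rcases eq_or_ne x y with rfl | hxy
  · fin_cases a <;> fin_cases b <;>
      simp [Fin.sum_univ_two, dampFactor, coinStep, hadamardSign, positionKernel,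
        blochKernel, positionBlochKernel, scalarKernel] <;> ring
  · have hd : x - y ≠ 0 := sub_ne_zero.2 hxy
    have hd' : y - x ≠ 0 := sub_ne_zero.2 hxy.symm
    fin_cases a <;> fin_cases b <;>
      simp [Fin.sum_univ_two, dampFactor, coinStep, hadamardSign, positionKernel,
        blochKernel, positionBlochKernel, scalarKernel, hxy, hd, hd']

theorem expect_scalarKernel (p : ℝ) (t : ℕ) (h : ℤ → ℝ) :
    expect p t (scalarKernel h) = h 0 := by
  induction t generalizing h with
  | zero => simp [expect, scalarKernel]
  | succ t ih =>
    rw [expect_succ, heisenberg_scalarKernel, ih]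
    simp
    ring

/-- The encoding of the Heisenberg evolution of `σ_z` after `n` steps. -/
def blochEvolve (p : ℝ) (n : ℕ) : BlochSeq := (fun s => blochRotate (blochDamp p s))^[n] blochZ

/-- The velocity autocorrelation of the decoherent walk. -/
def correlation (p : ℝ) (n : ℕ) : ℝ := (blochEvolve p n).1 0

theorem blochEvolve_succ (p : ℝ) (n : ℕ) :
    blochEvolve p (n + 1) = blochRotate (blochDamp p (blochEvolve p n)) :=
  Function.iterate_succ_apply' _ _ _

theorem blochDamp_blochZ (p : ℝ) : blochDamp p blochZ = blochZ := by
  ext d <;> simp [blochDamp, blochZ, ← add_mul]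

theorem blochEvolve_one (p : ℝ) : blochEvolve p 1 = blochRotate blochZ := by
  rw [blochEvolve_succ]
  exact congrArg _ (blochDamp_blochZ p)

theorem blochEvolve_even (p : ℝ) (n : ℕ) (d : ℤ) :
    (blochEvolve p n).1 (-d) = (blochEvolve p n).1 d := by
  cases n with
  | zero => rcases eq_or_ne d 0 with rfl | h <;> simp [blochEvolve, blochZ, *]
  | succ n => rw [blochEvolve_succ, blochRotate_even]

theorem expect_blochKernel (p : ℝ) (t n : ℕ) :
    expect p t (blochKernel (blochEvolve p n)) = 0 := by
  induction t generalizing n with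
  | zero => simp [expect, blochKernel]
  | succ t ih =>
    rw [expect_succ, heisenberg_blochKernel _ _ (blochEvolve_even p n), ← blochEvolve_succ, ih]

theorem expect_positionBlochKernel (p : ℝ) (t n : ℕ) :
    expect p t (positionBlochKernel (blochEvolve p n)) =
      2 * ∑ j ∈ Finset.range t, correlation p (n + j) := by
  induction t generalizing n with
  | zero => simp [expect, positionBlochKernel]
  | succ t ih =>
    rw [expect_succ, heisenberg_positionBlochKernel _ _ (blochEvolve_even p n),
      ← blochEvolve_succ, expect_add, expect_smul, expect_scalarKernel, ih,
      Finset.sum_range_succ', mul_add]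
    have : (blochDamp p (blochEvolve p n)).1 0 = correlation p n := by
      simp [blochDamp, blochZ, correlation]
      ring
    rw [this]
    simp only [add_zero, add_assoc, add_comm 1]

theorem expect_position (p : ℝ) (t : ℕ) : expect p t (positionKernel fun x => x) = 0 := by
  induction t with
  | zero => simp [expect, positionKernel]
  | succ t ih =>
    rw [expect_succ, heisenberg_positionKernel_id, expect_add, ih, ← blochEvolve_one p,
      expect_blochKernel, add_zero]

theorem correlation_zero (p : ℝ) : correlation p 0 = 1 := by
  simp [correlation, blochEvolve, blochZ]

theorem expect_position_sq (p : ℝ) (t : ℕ) :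
    expect p t (positionKernel fun x => (x : ℝ) ^ 2) =
      2 * ∑ n ∈ Finset.range t, ((t : ℝ) - n) * correlation p n - t := by
  induction t with
  | zero => simp [expect, positionKernel]
  | succ t ih =>
    rw [expect_succ, heisenberg_positionKernel_sq, expect_add, expect_add, ih,
      ← blochEvolve_one p, expect_positionBlochKernel, expect_scalarKernel]
    have hshift : ∑ j ∈ Finset.range t, correlation p (1 + j) =
        ∑ n ∈ Finset.range (t + 1), correlation p n - 1 := by
      rw [Finset.sum_range_succ', correlation_zero]
      simp only [add_comm 1, add_sub_cancel_right]
    have hsplit : ∑ n ∈ Finset.range (t + 1), (((t + 1 : ℕ) : ℝ) - n) * correlation p n =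
        ∑ n ∈ Finset.range t, ((t : ℝ) - n) * correlation p n +
          ∑ n ∈ Finset.range (t + 1), correlation p n := by
      rw [Finset.sum_range_succ, Finset.sum_range_succ (fun n => correlation p n), ← add_assoc,
        ← Finset.sum_add_distrib]
      push_cast
      congr 1
      · exact Finset.sum_congr rfl fun n _ => by ring
      · ring
    rw [hshift, hsplit]
    push_cast
    simp
    ring

theorem symVar_eq {p : ℝ} (hp0 : 0 ≤ p) (hp1 : p ≤ 1) (t : ℕ) :
    symVar p t = 2 * ∑ n ∈ Finset.range t, ((t : ℝ) - n) * correlation p n - t := by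
  rw [symVar, tsum_mul_PsymProb hp0 hp1 (fun x => (x : ℝ) ^ 2),
    tsum_mul_PsymProb hp0 hp1 (fun x => (x : ℝ)), expect_position_sq, expect_position]
  ring

/-- The velocity autocorrelation of the pure Hadamard walk. -/
def pureCorrelation (n : ℕ) : ℝ := ((blochRotate ^ n) blochZ).1 0

theorem blochEvolve_eq (p : ℝ) (n : ℕ) :
    blochEvolve p n = (1 - p) ^ n • (blochRotate ^ n) blochZ +
      ∑ i ∈ Finset.range n, (p * correlation p i * (1 - p) ^ (n - 1 - i)) •
        (blochRotate ^ (n - 1 - i + 1)) blochZ := by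
  induction n with
  | zero => simp [blochEvolve]
  | succ n ih =>
    have hd : blochDamp p (blochEvolve p n) =
        (1 - p) • blochEvolve p n + (p * correlation p n) • blochZ := rfl
    have hrot : ∀ k, blochRotate ((blochRotate ^ k) blochZ) = (blochRotate ^ (k + 1)) blochZ :=
      fun k => by rw [pow_succ']; rfl
    rw [blochEvolve_succ, hd, ih, Finset.sum_range_succ]
    simp only [map_add, map_smul, map_sum, smul_add, Finset.smul_sum, hrot, smul_smul,
      ← pow_succ', add_assoc]
    congr 2
    · refine Finset.sum_congr rfl fun i hi => ?_
      have hi' := Finset.mem_range.1 hi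
      have h1 : n + 1 - 1 - i = n - 1 - i + 1 := by omega
      rw [h1]
      congr 1
      ring
    · simp

theorem correlation_succ (p : ℝ) (n : ℕ) :
    correlation p (n + 1) = (1 - p) ^ (n + 1) * pureCorrelation (n + 1) +
      ∑ i ∈ Finset.range (n + 1), correlation p i *
        (p * ((1 - p) ^ (n - i) * pureCorrelation (n - i + 1))) := by
  have h := congrArg (fun s : BlochSeq => s.1 0) (blochEvolve_eq p (n + 1))
  simp only [Prod.fst_add, Prod.fst_sum, Prod.smul_fst, Pi.add_apply, Finset.sum_apply,
    Pi.smul_apply, smul_eq_mul, Nat.add_sub_cancel] at h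
  rw [correlation, h]
  refine congrArg₂ _ rfl (Finset.sum_congr rfl fun i _ => ?_)
  simp only [pureCorrelation]
  ring

theorem pureCorrelation_zero : pureCorrelation 0 = 1 := by
  simp [pureCorrelation, blochZ]

theorem pureCorrelation_one : pureCorrelation 1 = 0 := by
  simp [pureCorrelation, blochRotate_blochZ]

/-- The orbit of the north pole under the Bloch sphere rotation of the Hadamard step at
momentum `θ`. -/
def blochVector (θ : ℝ) : ℕ → ℝ × ℝ × ℝ
  | 0 => (0, 0, 1)
  | n + 1 => ((blochVector θ n).2.2,
      Real.sin (2 * θ) * (blochVector θ n).1 - Real.cos (2 * θ) * (blochVector θ n).2.1,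
      Real.cos (2 * θ) * (blochVector θ n).1 + Real.sin (2 * θ) * (blochVector θ n).2.1)

@[fun_prop]
theorem continuous_blochVector (n : ℕ) : Continuous fun θ => blochVector θ n := by
  induction n with
  | zero => exact continuous_const
  | succ n ih =>
    simp only [blochVector]
    fun_prop

theorem blochVector_norm_sq (θ : ℝ) (n : ℕ) :
    (blochVector θ n).1 ^ 2 + (blochVector θ n).2.1 ^ 2 + (blochVector θ n).2.2 ^ 2 = 1 := by
  induction n with
  | zero => simp [blochVector]
  | succ n ih =>
    simp only [blochVector]
    linear_combination ih + ((blochVector θ n).1 ^ 2 + (blochVector θ n).2.1 ^ 2) *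
      Real.sin_sq_add_cos_sq (2 * θ)

theorem integral_cos_int_mul (d : ℤ) :
    1 / (2 * Real.pi) * ∫ θ in (0 : ℝ)..2 * Real.pi, Real.cos (d * θ) =
      (Pi.single 0 1 : ℤ → ℝ) d := by
  have hpi := Real.pi_ne_zero
  rcases eq_or_ne d 0 with rfl | hd
  · simp
    field_simp
  · have hd' : (d : ℝ) ≠ 0 := Int.cast_ne_zero.2 hd
    have hsin : Real.sin (d * (2 * Real.pi)) = 0 := by
      have := Real.sin_int_mul_pi (d * 2)
      push_cast at this
      rwa [mul_assoc] at this
    rw [intervalIntegral.integral_comp_mul_left (fun x => Real.cos x) hd', integral_cos, hsin]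
    simp [hd]

theorem blochRotate_pow_eq_integral (n : ℕ) : ∀ d : ℤ,
    ((blochRotate ^ n) blochZ).1 d = 1 / (2 * Real.pi) * ∫ θ in (0 : ℝ)..2 * Real.pi,
      Real.cos (d * θ) * (blochVector θ n).2.2 ∧
    ((blochRotate ^ n) blochZ).2 d = 1 / (2 * Real.pi) * ∫ θ in (0 : ℝ)..2 * Real.pi,
      (Real.cos (d * θ) * (blochVector θ n).1 + Real.sin (d * θ) * (blochVector θ n).2.1) := by
  induction n with
  | zero =>
    intro d
    constructor
    · simp only [blochVector, mul_one, integral_cos_int_mul]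
      rfl
    · simp [blochVector, blochZ]
  | succ n ih =>
    intro d
    have hstep : (blochRotate ^ (n + 1)) blochZ = blochRotate ((blochRotate ^ n) blochZ) := by
      rw [pow_succ']
      rfl
    rw [hstep]
    simp only [blochRotate_apply, (ih _).1, (ih _).2]
    have hint : ∀ e : ℤ, IntervalIntegrable (fun θ : ℝ => Real.cos (e * θ) * (blochVector θ n).1 +
        Real.sin (e * θ) * (blochVector θ n).2.1) MeasureTheory.volume 0 (2 * Real.pi) :=
      fun e => Continuous.intervalIntegrable (by fun_prop) _ _
    have hint' : IntervalIntegrable (fun θ : ℝ => Real.cos (d * θ) * (blochVector θ n).2.2)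
        MeasureTheory.volume 0 (2 * Real.pi) :=
      Continuous.intervalIntegrable (by fun_prop) _ _
    constructor
    · rw [← mul_add, ← intervalIntegral.integral_add (hint _) (hint _), mul_div_assoc,
        ← intervalIntegral.integral_div]
      congr 1
      refine intervalIntegral.integral_congr fun θ _ => ?_
      simp only [blochVector]
      push_cast
      simp only [add_mul, sub_mul, Real.cos_add, Real.cos_sub, Real.sin_add, Real.sin_sub]
      ring
    · rw [← mul_sub, ← intervalIntegral.integral_sub (hint _) (hint _), mul_div_assoc,
        ← intervalIntegral.integral_div, ← mul_add, ← intervalIntegral.integral_add hint'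
          (((hint _).sub (hint _)).div_const 2)]
      congr 1
      refine intervalIntegral.integral_congr fun θ _ => ?_
      simp only [blochVector]
      push_cast
      simp only [add_mul, sub_mul, Real.cos_add, Real.cos_sub, Real.sin_add, Real.sin_sub]
      ring

theorem pureCorrelation_eq_integral (n : ℕ) :
    pureCorrelation n =
      1 / (2 * Real.pi) * ∫ θ in (0 : ℝ)..2 * Real.pi, (blochVector θ n).2.2 := by
  simpa [pureCorrelation] using (blochRotate_pow_eq_integral n 0).1

theorem abs_blochVector_le (θ : ℝ) (n : ℕ) : |(blochVector θ n).1| ≤ 1 ∧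
    |(blochVector θ n).2.1| ≤ 1 ∧ |(blochVector θ n).2.2| ≤ 1 := by
  have h := blochVector_norm_sq θ n
  refine ⟨?_, ?_, ?_⟩ <;> rw [← sq_le_one_iff_abs_le_one] <;>
    nlinarith [sq_nonneg (blochVector θ n).1, sq_nonneg (blochVector θ n).2.1,
      sq_nonneg (blochVector θ n).2.2]

theorem abs_pureCorrelation_le (n : ℕ) : |pureCorrelation n| ≤ 1 := by
  have hpi := Real.pi_pos
  have h := intervalIntegral.norm_integral_le_of_norm_le_const (a := 0) (b := 2 * Real.pi)
    (f := fun θ => (blochVector θ n).2.2) (C := 1) fun θ _ => (abs_blochVector_le θ n).2.2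
  rw [Real.norm_eq_abs, sub_zero, abs_of_pos (by positivity : 0 < 2 * Real.pi), one_mul] at h
  rw [pureCorrelation_eq_integral, abs_mul, abs_of_pos (by positivity), one_div,
    inv_mul_le_iff₀ (by positivity), mul_one]
  exact h

/-- The resolvent of the Bloch sphere rotation at the north pole. -/
theorem hasSum_blochVector {u : ℝ} (hu0 : 0 ≤ u) (hu1 : u < 1) (θ : ℝ) :
    HasSum (fun n => (blochVector θ n).2.2 * u ^ n) ((1 + u * Real.cos (2 * θ)) /
      ((1 - u) * (1 + u + u ^ 2 + u * Real.cos (2 * θ)))) := by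
  have hsum : ∀ f : ℕ → ℝ, (∀ n, |f n| ≤ 1) → Summable fun n => f n * u ^ n := fun f hf =>
    Summable.of_norm_bounded (summable_geometric_of_lt_one hu0 hu1) fun n => by
      rw [norm_mul, norm_pow, Real.norm_of_nonneg hu0, Real.norm_eq_abs]
      exact mul_le_of_le_one_left (pow_nonneg hu0 n) (hf n)
  have hx := hsum _ fun n => (abs_blochVector_le θ n).1
  have hy := hsum _ fun n => (abs_blochVector_le θ n).2.1
  have hz := hsum _ fun n => (abs_blochVector_le θ n).2.2
  have ex : ∑' n, (blochVector θ n).1 * u ^ n = u * ∑' n, (blochVector θ n).2.2 * u ^ n := by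
    rw [hx.tsum_eq_zero_add, ← tsum_mul_left]
    simp only [blochVector, zero_mul, zero_add]
    exact tsum_congr fun n => by ring
  have ey : ∑' n, (blochVector θ n).2.1 * u ^ n =
      u * (Real.sin (2 * θ) * ∑' n, (blochVector θ n).1 * u ^ n -
        Real.cos (2 * θ) * ∑' n, (blochVector θ n).2.1 * u ^ n) := by
    conv_lhs => rw [hy.tsum_eq_zero_add]
    rw [← tsum_mul_left, ← tsum_mul_left, ← (hx.mul_left _).tsum_sub (hy.mul_left _),
      ← tsum_mul_left]
    simp only [blochVector, zero_mul, zero_add]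
    exact tsum_congr fun n => by ring
  have ez : ∑' n, (blochVector θ n).2.2 * u ^ n =
      1 + u * (Real.cos (2 * θ) * ∑' n, (blochVector θ n).1 * u ^ n +
        Real.sin (2 * θ) * ∑' n, (blochVector θ n).2.1 * u ^ n) := by
    conv_lhs => rw [hz.tsum_eq_zero_add]
    rw [← tsum_mul_left, ← tsum_mul_left, ← (hx.mul_left _).tsum_add (hy.mul_left _),
      ← tsum_mul_left]
    simp only [blochVector, pow_zero, mul_one]
    congr 1
    exact tsum_congr fun n => by ring
  have hc := Real.neg_one_le_cos (2 * θ)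
  have hden : 0 < (1 - u) * (1 + u + u ^ 2 + u * Real.cos (2 * θ)) :=
    mul_pos (by linarith) (by nlinarith)
  convert hz.hasSum using 1
  rw [div_eq_iff hden.ne']
  have hsc := Real.sin_sq_add_cos_sq (2 * θ)
  rw [ex] at ey ez
  generalize ∑' n, (blochVector θ n).2.2 * u ^ n = Z at *
  generalize ∑' n, (blochVector θ n).2.1 * u ^ n = Y at *
  linear_combination (-(1 + u * Real.cos (2 * θ))) * ez - u * Real.sin (2 * θ) * ey
    - u ^ 3 * Z * hsc

theorem integral_poisson {r : ℝ} (hr : |r| < 1) :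
    ∫ θ in (0 : ℝ)..2 * Real.pi, (1 - r ^ 2) / (1 + r ^ 2 + 2 * r * Real.cos (2 * θ)) =
      2 * Real.pi := by
  have hpos : ∀ θ : ℝ, 0 < 1 + r * Real.cos (2 * θ) := fun θ => by
    have h : |r * Real.cos (2 * θ)| < 1 := by
      rw [abs_mul]
      exact (mul_le_of_le_one_right (abs_nonneg r) (Real.abs_cos_le_one _)).trans_lt hr
    linarith [(abs_lt.1 h).1]
  have hpos' : ∀ θ : ℝ, 0 < 1 + r ^ 2 + 2 * r * Real.cos (2 * θ) := fun θ => by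
    nlinarith [Real.sin_sq_add_cos_sq (2 * θ), hpos θ, pow_pos (hpos θ) 2,
      sq_nonneg (r * Real.sin (2 * θ))]
  have hderiv : ∀ θ : ℝ, HasDerivAt
      (fun θ => θ - Real.arctan (r * Real.sin (2 * θ) / (1 + r * Real.cos (2 * θ))))
      ((1 - r ^ 2) / (1 + r ^ 2 + 2 * r * Real.cos (2 * θ))) θ := by
    intro θ
    have h2 : HasDerivAt (fun θ : ℝ => 2 * θ) 2 θ := by
      simpa using (hasDerivAt_id θ).const_mul 2
    have hs := (h2.sin.const_mul r).div ((h2.cos.const_mul r).const_add 1) (hpos θ).ne'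
    refine ((hasDerivAt_id θ).sub hs.arctan).congr_deriv ?_
    have := (hpos θ).ne'
    have hsq : 1 + (r * Real.sin (2 * θ) / (1 + r * Real.cos (2 * θ))) ^ 2 =
        (1 + r ^ 2 + 2 * r * Real.cos (2 * θ)) / (1 + r * Real.cos (2 * θ)) ^ 2 := by
      field_simp
      linear_combination r ^ 2 * Real.sin_sq_add_cos_sq (2 * θ)
    have hcancel : ∀ {E P N : ℝ}, E ≠ 0 → P ≠ 0 →
        1 - 1 / (E / P ^ 2) * (N / P ^ 2) = (E - N) / E := fun hE hP => by
      field_simp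
    simp only [Pi.div_apply]
    rw [hsq, hcancel (hpos' θ).ne' (hpos θ).ne']
    congr 1
    linear_combination -2 * r ^ 2 * Real.sin_sq_add_cos_sq (2 * θ)
  rw [intervalIntegral.integral_eq_sub_of_hasDerivAt fun θ _ => hderiv θ]
  · have : Real.sin (2 * (2 * Real.pi)) = 0 := by
      simpa using Real.sin_nat_mul_pi 4 ▸ congrArg Real.sin (by push_cast; ring)
    simp [this]
  · refine Continuous.intervalIntegrable ?_ _ _
    exact Continuous.div (by fun_prop) (by fun_prop) fun θ => (hpos' θ).ne'

theorem integral_inv_add_mul_cos {a u : ℝ} (hu : |u| < a) :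
    ∫ θ in (0 : ℝ)..2 * Real.pi, (a + u * Real.cos (2 * θ))⁻¹ =
      2 * Real.pi / Real.sqrt (a ^ 2 - u ^ 2) := by
  set D := Real.sqrt (a ^ 2 - u ^ 2) with hD
  have ha : 0 < a := (abs_nonneg u).trans_lt hu
  have hsub : 0 < a ^ 2 - u ^ 2 := sub_pos.2 (sq_lt_sq.2 (by rwa [abs_of_pos ha]))
  have hDpos : 0 < D := Real.sqrt_pos.2 hsub
  have hDsq : D ^ 2 = a ^ 2 - u ^ 2 := Real.sq_sqrt hsub.le
  have hr : |u / (a + D)| < 1 := by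
    rw [abs_div, abs_of_pos (by positivity : 0 < a + D), div_lt_one (by positivity)]
    linarith
  have hscale : ∀ θ : ℝ, (1 - (u / (a + D)) ^ 2) /
      (1 + (u / (a + D)) ^ 2 + 2 * (u / (a + D)) * Real.cos (2 * θ)) =
      D * (a + u * Real.cos (2 * θ))⁻¹ := by
    intro θ
    have hpos : 0 < a + u * Real.cos (2 * θ) := by
      have h : |u * Real.cos (2 * θ)| < a := by
        rw [abs_mul]
        exact (mul_le_of_le_one_right (abs_nonneg u) (Real.abs_cos_le_one _)).trans_lt hu
      linarith [(abs_lt.1 h).1]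
    have hnum : 1 - (u / (a + D)) ^ 2 = 2 * D / (a + D) := by
      field_simp
      linear_combination -hDsq
    have hden : 1 + (u / (a + D)) ^ 2 + 2 * (u / (a + D)) * Real.cos (2 * θ) =
        2 * (a + u * Real.cos (2 * θ)) / (a + D) := by
      field_simp
      linear_combination hDsq
    simp only [hnum, hden]
    field_simp
  have hmain := integral_poisson hr
  simp only [hscale, intervalIntegral.integral_const_mul] at hmain
  rw [eq_div_iff hDpos.ne', mul_comm, hmain]

theorem hasSum_pureCorrelation {u : ℝ} (hu0 : 0 ≤ u) (hu1 : u < 1) :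
    HasSum (fun n => pureCorrelation n * u ^ n) ((1 - u / Real.sqrt (1 + u ^ 2)) / (1 - u)) := by
  have hpi := Real.pi_pos
  have h := intervalIntegral.hasSum_integral_of_dominated_convergence (a := 0)
    (b := 2 * Real.pi) (μ := MeasureTheory.volume)
    (F := fun n θ => (blochVector θ n).2.2 * u ^ n) (fun n _ => u ^ n)
    (fun n => Continuous.aestronglyMeasurable (by fun_prop))
    (fun n => .of_forall fun θ _ => by
      rw [norm_mul, norm_pow, Real.norm_of_nonneg hu0, Real.norm_eq_abs]
      exact mul_le_of_le_one_left (pow_nonneg hu0 n) (abs_blochVector_le θ n).2.2)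
    (.of_forall fun _ _ => summable_geometric_of_lt_one hu0 hu1)
    intervalIntegrable_const
    (.of_forall fun θ _ => hasSum_blochVector hu0 hu1 θ)
  have hval : 1 / (2 * Real.pi) * ∫ θ in (0 : ℝ)..2 * Real.pi, (1 + u * Real.cos (2 * θ)) /
      ((1 - u) * (1 + u + u ^ 2 + u * Real.cos (2 * θ))) =
      (1 - u / Real.sqrt (1 + u ^ 2)) / (1 - u) := by
    have hu : |u| < 1 + u + u ^ 2 := by
      rw [abs_of_nonneg hu0]
      nlinarith
    have hpos : ∀ θ : ℝ, 0 < 1 + u + u ^ 2 + u * Real.cos (2 * θ) := fun θ => by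
      nlinarith [Real.neg_one_le_cos (2 * θ)]
    have hrw : ∀ θ : ℝ, (1 + u * Real.cos (2 * θ)) /
        ((1 - u) * (1 + u + u ^ 2 + u * Real.cos (2 * θ))) =
        (1 - u)⁻¹ - u * (1 + u) / (1 - u) * (1 + u + u ^ 2 + u * Real.cos (2 * θ))⁻¹ := by
      intro θ
      have := (hpos θ).ne'
      have : 1 - u ≠ 0 := by linarith
      field_simp
      ring
    have hD : Real.sqrt ((1 + u + u ^ 2) ^ 2 - u ^ 2) = (1 + u) * Real.sqrt (1 + u ^ 2) := by
      rw [show (1 + u + u ^ 2) ^ 2 - u ^ 2 = (1 + u) ^ 2 * (1 + u ^ 2) by ring,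
        Real.sqrt_mul (by positivity), Real.sqrt_sq (by linarith)]
    simp only [hrw]
    rw [intervalIntegral.integral_sub intervalIntegrable_const
      (Continuous.intervalIntegrable (by
        exact continuous_const.mul (Continuous.inv₀ (by fun_prop) fun θ => (hpos θ).ne')) _ _),
      intervalIntegral.integral_const_mul, integral_inv_add_mul_cos hu, hD]
    have : 1 - u ≠ 0 := by linarith
    have : 1 + u ≠ 0 := by linarith
    simp
    field_simp
  have hfun : (fun n => pureCorrelation n * u ^ n) = fun n => 1 / (2 * Real.pi) *
      ∫ θ in (0 : ℝ)..2 * Real.pi, (blochVector θ n).2.2 * u ^ n := by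
    funext n
    rw [pureCorrelation_eq_integral, intervalIntegral.integral_mul_const, mul_assoc]
  rw [hfun, ← hval]
  exact h.mul_left _

theorem abs_correlation_le {p : ℝ} (hp0 : 0 < p) (hp1 : p ≤ 1) (n : ℕ) :
    |correlation p n| ≤ (1 - p ^ 2 / 2) ^ n := by
  set l := 1 - p ^ 2 / 2 with hl
  have hq : 0 ≤ 1 - p := by linarith
  have hl0 : 0 < l := by nlinarith
  have hql : 1 - p ≤ l := by nlinarith
  have hrec : p * (1 - p) + (1 - p) * l ≤ l ^ 2 := by
    rw [hl]
    nlinarith [mul_nonneg hq (pow_pos hp0 2).le, pow_pos hp0 3, pow_pos hp0 4]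
  have hmajor : ∀ n : ℕ, (1 - p) ^ (n + 1) + ∑ i ∈ Finset.range n,
      l ^ i * (p * (1 - p) ^ (n - i)) ≤ l ^ (n + 1) := by
    intro n
    induction n with
    | zero => simpa using hql
    | succ n ih =>
      have hsplit : (1 - p) ^ (n + 2) + ∑ i ∈ Finset.range (n + 1),
          l ^ i * (p * (1 - p) ^ (n + 1 - i)) =
          (1 - p) * ((1 - p) ^ (n + 1) + ∑ i ∈ Finset.range n,
            l ^ i * (p * (1 - p) ^ (n - i))) + l ^ n * (p * (1 - p)) := by
        rw [Finset.sum_range_succ, mul_add, Finset.mul_sum, ← add_assoc, ← pow_succ']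
        congr 1
        · congr 1
          refine Finset.sum_congr rfl fun i hi => ?_
          rw [Nat.succ_sub (Finset.mem_range.1 hi).le, pow_succ]
          ring
        · simp
      rw [hsplit]
      calc _ ≤ (1 - p) * l ^ (n + 1) + l ^ n * (p * (1 - p)) := by gcongr
        _ = l ^ n * (p * (1 - p) + (1 - p) * l) := by ring
        _ ≤ l ^ n * l ^ 2 := by gcongr
        _ = l ^ (n + 1 + 1) := by ring
  induction n using Nat.strong_induction_on with
  | _ n ih =>
    cases n with
    | zero => simp [correlation_zero]
    | succ n =>
      refine le_trans ?_ (hmajor n)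
      rw [correlation_succ, Finset.sum_range_succ, Nat.sub_self, zero_add, pureCorrelation_one]
      simp only [mul_zero, add_zero]
      have hw : ∀ k m : ℕ, |(1 - p) ^ k * pureCorrelation m| ≤ (1 - p) ^ k := fun k m => by
        rw [abs_mul, abs_of_nonneg (pow_nonneg hq k)]
        exact mul_le_of_le_one_right (pow_nonneg hq k) (abs_pureCorrelation_le m)
      refine (abs_add_le _ _).trans (add_le_add (hw _ _) ?_)
      refine (Finset.abs_sum_le_sum_abs _ _).trans (Finset.sum_le_sum fun i hi => ?_)
      rw [abs_mul, abs_mul, abs_of_pos hp0]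
      have hi' := Finset.mem_range.1 hi
      exact mul_le_mul (ih i (by omega)) (mul_le_mul_of_nonneg_left (hw _ _) hp0.le)
        (by positivity) (by positivity)

theorem summable_pureCorrelation_mul_pow {u : ℝ} (hu0 : 0 ≤ u) (hu1 : u < 1) :
    Summable fun n => ‖pureCorrelation (n + 1) * u ^ n‖ :=
  Summable.of_nonneg_of_le (fun _ => norm_nonneg _) (fun n => by
    rw [norm_mul, norm_pow, Real.norm_of_nonneg hu0, Real.norm_eq_abs]
    exact mul_le_of_le_one_left (pow_nonneg hu0 n) (abs_pureCorrelation_le _))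
    (summable_geometric_of_lt_one hu0 hu1)

theorem tsum_pureCorrelation_succ {u : ℝ} (hu0 : 0 ≤ u) (hu1 : u < 1) :
    ∑' n, pureCorrelation (n + 1) * u ^ n = (1 - 1 / Real.sqrt (1 + u ^ 2)) / (1 - u) := by
  rcases hu0.eq_or_lt with rfl | hu
  · rw [tsum_eq_single 0 fun n hn => by simp [hn]]
    simp [pureCorrelation_one]
  · have h := hasSum_pureCorrelation hu0 hu1
    have hsum := h.tsum_eq
    rw [h.summable.tsum_eq_zero_add, pureCorrelation_zero] at hsum
    have hshift : ∑' n, pureCorrelation (n + 1) * u ^ (n + 1) =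
        u * ∑' n, pureCorrelation (n + 1) * u ^ n := by
      rw [← tsum_mul_left]
      exact tsum_congr fun n => by ring
    rw [hshift] at hsum
    have h1 : 1 - u ≠ 0 := by linarith
    have hs : Real.sqrt (1 + u ^ 2) ≠ 0 := (Real.sqrt_pos.2 (by positivity)).ne'
    have hmul : u * ∑' n, pureCorrelation (n + 1) * u ^ n =
        u * ((1 - 1 / Real.sqrt (1 + u ^ 2)) / (1 - u)) := by
      rw [pow_zero, mul_one] at hsum
      rw [← sub_eq_iff_eq_add'.2 hsum.symm]
      field_simp
      ring
    exact mul_left_cancel₀ hu.ne' hmul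

theorem summable_correlation_mul_pow {p z : ℝ} (hp0 : 0 < p) (hp1 : p ≤ 1) (hz0 : 0 ≤ z)
    (hz1 : (1 - p ^ 2 / 2) * z < 1) : Summable fun n => ‖correlation p n * z ^ n‖ := by
  have hl0 : 0 ≤ 1 - p ^ 2 / 2 := by nlinarith
  refine Summable.of_nonneg_of_le (fun _ => norm_nonneg _) (fun n => ?_)
    (summable_geometric_of_lt_one (mul_nonneg hl0 hz0) hz1)
  rw [norm_mul, norm_pow, Real.norm_of_nonneg hz0, Real.norm_eq_abs, mul_pow]
  exact mul_le_mul_of_nonneg_right (abs_correlation_le hp0 hp1 n) (pow_nonneg hz0 n)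

theorem tsum_correlation_mul_pow {p z : ℝ} (hp0 : 0 < p) (hp1 : p ≤ 1) (hz0 : 0 ≤ z)
    (hz1 : (1 - p ^ 2 / 2) * z < 1) :
    (∑' n, correlation p n * z ^ n) * ((1 - z) * Real.sqrt (1 + ((1 - p) * z) ^ 2) + p * z) =
      Real.sqrt (1 + ((1 - p) * z) ^ 2) - (1 - p) * z := by
  have hb := summable_correlation_mul_pow hp0 hp1 hz0 hz1
  have hq : 0 ≤ 1 - p := by linarith
  have hu0 : 0 ≤ (1 - p) * z := mul_nonneg hq hz0
  have hu1 : (1 - p) * z < 1 :=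
    (mul_le_mul_of_nonneg_right (by nlinarith) hz0).trans_lt hz1
  have hw := summable_pureCorrelation_mul_pow hu0 hu1
  have hH := tsum_pureCorrelation_succ hu0 hu1
  have hprod := tsum_mul_tsum_eq_tsum_sum_range_of_summable_norm hb hw
  have hprods := (summable_norm_sum_mul_range_of_summable_norm hb hw).of_norm
  have hrenewal : ∑' n, correlation p n * z ^ n =
      1 + ((1 - p) * z * ∑' n, pureCorrelation (n + 1) * ((1 - p) * z) ^ n +
        p * z * ((∑' n, correlation p n * z ^ n) *
          ∑' n, pureCorrelation (n + 1) * ((1 - p) * z) ^ n)) := by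
    conv_lhs => rw [hb.of_norm.tsum_eq_zero_add]
    rw [hprod, ← tsum_mul_left, ← tsum_mul_left,
      ← (hw.of_norm.mul_left _).tsum_add (hprods.mul_left _), correlation_zero, pow_zero, mul_one]
    congr 1
    refine tsum_congr fun n => ?_
    rw [correlation_succ, add_mul, Finset.sum_mul, Finset.mul_sum]
    congr 1
    · rw [mul_pow]
      ring
    · refine Finset.sum_congr rfl fun i hi => ?_
      have hi' : n + 1 = i + (n - i) + 1 := by have := Finset.mem_range.1 hi; omega
      rw [congrArg (z ^ ·) hi', mul_pow]
      ring
  have hs : Real.sqrt (1 + ((1 - p) * z) ^ 2) ≠ 0 := (Real.sqrt_pos.2 (by positivity)).ne'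
  have h1 : 1 - (1 - p) * z ≠ 0 := by linarith
  rw [hH] at hrenewal
  generalize ∑' n, correlation p n * z ^ n = B at *
  generalize Real.sqrt (1 + ((1 - p) * z) ^ 2) = s at *
  field_simp at hrenewal
  linear_combination hrenewal

theorem hasDerivAt_tsum_correlation {p : ℝ} (hp0 : 0 < p) (hp1 : p ≤ 1) :
    HasDerivAt (fun z => ∑' n, correlation p n * z ^ n) (∑' n, n * correlation p n) 1 := by
  set l := 1 - p ^ 2 / 2 with hl
  have hl0 : 0 < l := by nlinarith
  have hl1 : l < 1 := by nlinarith
  set R := (1 + p ^ 2 / 2) with hR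
  have hR1 : 1 < R := by nlinarith
  have hlR : l * R < 1 := by nlinarith [pow_pos hp0 4]
  have hlR0 : 0 ≤ l * R := by positivity
  have hmaj : Summable fun n : ℕ => (n : ℝ) * (l * R) ^ n := by
    simpa using summable_pow_mul_geometric_of_norm_lt_one 1
      (by rwa [Real.norm_of_nonneg hlR0] : ‖l * R‖ < 1)
  have key := hasDerivAt_tsum_of_isPreconnected (𝕜 := ℝ) (t := Set.Ioo 0 R) (y₀ := 1) (y := 1)
    (g := fun n z => correlation p n * z ^ n)
    (g' := fun n z => correlation p n * (n * z ^ (n - 1))) hmaj isOpen_Ioo isPreconnected_Ioo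
    (fun n z _ => (hasDerivAt_pow n z).const_mul _) (fun n z hz => ?_) ⟨one_pos, hR1⟩
    (summable_correlation_mul_pow hp0 hp1 zero_le_one (by rwa [mul_one])).of_norm
    ⟨one_pos, hR1⟩
  · convert! key using 3 with n
    ring
  · have hz0 : 0 ≤ z := hz.1.le
    have hzR : z ^ (n - 1) ≤ R ^ n :=
      (pow_le_pow_left₀ hz0 hz.2.le _).trans (pow_le_pow_right₀ hR1.le (Nat.sub_le n 1))
    rw [norm_mul, Real.norm_eq_abs, Real.norm_of_nonneg (by positivity), mul_pow]
    calc _ ≤ l ^ n * (n * R ^ n) := by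
          gcongr
          exact abs_correlation_le hp0 hp1 n
      _ = _ := by ring

theorem tsum_correlation {p : ℝ} (hp0 : 0 < p) (hp1 : p ≤ 1) :
    ∑' n, correlation p n = (Real.sqrt (1 + (1 - p) ^ 2) - (1 - p)) / p := by
  have h := tsum_correlation_mul_pow hp0 hp1 zero_le_one (by nlinarith)
  simp only [one_pow, mul_one, sub_self, zero_mul, zero_add] at h
  rw [eq_div_iff hp0.ne', h]

theorem tsum_mul_correlation {p : ℝ} (hp0 : 0 < p) (hp1 : p ≤ 1) :
    ∑' n, n * correlation p n = (p * (1 - p) ^ 2 / Real.sqrt (1 + (1 - p) ^ 2) +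
      (1 + (1 - p) ^ 2) - Real.sqrt (1 + (1 - p) ^ 2)) / p ^ 2 := by
  have hB := hasDerivAt_tsum_correlation hp0 hp1
  have hq : HasDerivAt (fun z : ℝ => (1 - p) * z) (1 - p) 1 := by
    simpa using (hasDerivAt_id (1 : ℝ)).const_mul (1 - p)
  have hs : HasDerivAt (fun z : ℝ => Real.sqrt (1 + ((1 - p) * z) ^ 2))
      ((1 - p) ^ 2 / Real.sqrt (1 + (1 - p) ^ 2)) 1 := by
    have h := ((hq.fun_pow 2).const_add 1).sqrt (by positivity)
    refine h.congr_deriv ?_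
    simp only [mul_one]
    push_cast
    field_simp
  have hid := hasDerivAt_id' (1 : ℝ)
  have hlhs := hB.fun_mul (((hid.const_sub 1).fun_mul hs).fun_add (hid.const_mul p))
  have hrhs := hs.fun_sub hq
  have heq : (fun z : ℝ => (∑' n, correlation p n * z ^ n) *
      ((1 - z) * Real.sqrt (1 + ((1 - p) * z) ^ 2) + p * z)) =ᶠ[nhds 1]
      fun z => Real.sqrt (1 + ((1 - p) * z) ^ 2) - (1 - p) * z := by
    have h0 : ∀ᶠ z : ℝ in nhds 1, 0 ≤ z := eventually_ge_nhds one_pos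
    have h1 : ∀ᶠ z : ℝ in nhds 1, (1 - p ^ 2 / 2) * z < 1 :=
      (continuous_const.mul continuous_id).continuousAt.eventually_lt continuousAt_const
        (by simp; positivity)
    filter_upwards [h0, h1] with z hz0 hz1
    exact tsum_correlation_mul_pow hp0 hp1 hz0 hz1
  have h := hlhs.unique (hrhs.congr_of_eventuallyEq heq)
  simp only [one_pow, mul_one, sub_self, zero_mul, zero_add, add_zero,
    tsum_correlation hp0 hp1] at h
  have hspos : 0 < Real.sqrt (1 + (1 - p) ^ 2) := Real.sqrt_pos.2 (by positivity)
  have hsq : Real.sqrt (1 + (1 - p) ^ 2) ^ 2 = 1 + (1 - p) ^ 2 := Real.sq_sqrt (by positivity)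
  generalize Real.sqrt (1 + (1 - p) ^ 2) = s at *
  rw [eq_div_iff (by positivity)]
  field_simp at h ⊢
  linear_combination h + s * hsq

/-- The Cesàro-type sum of an exponentially decaying sequence, up to exponentially small error. -/
theorem abs_sum_range_sub_mul_sub_le {b : ℕ → ℝ} {l : ℝ} (hl0 : 0 < l) (hl1 : l < 1)
    (hb : ∀ n, |b n| ≤ l ^ n) (t : ℕ) :
    |∑ n ∈ Finset.range t, ((t : ℝ) - n) * b n - (t * ∑' n, b n - ∑' n, n * b n)| ≤
      (∑' n : ℕ, (n : ℝ) * l ^ n) * l ^ t := by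
  have hmaj : Summable fun n : ℕ => (n : ℝ) * l ^ n := by
    simpa using summable_pow_mul_geometric_of_norm_lt_one 1
      (by rwa [Real.norm_of_nonneg hl0.le] : ‖l‖ < 1)
  have h0 : Summable b :=
    Summable.of_norm_bounded (summable_geometric_of_lt_one hl0.le hl1) hb
  have h1 : Summable fun n : ℕ => (n : ℝ) * b n :=
    Summable.of_norm_bounded hmaj fun n => by
      rw [norm_mul, Real.norm_of_nonneg n.cast_nonneg]
      exact mul_le_mul_of_nonneg_left (hb n) n.cast_nonneg
  have hsum : Summable fun n : ℕ => ((t : ℝ) - n) * b n := by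
    simpa only [sub_mul] using (h0.mul_left (t : ℝ)).sub h1
  have htot : t * ∑' n, b n - ∑' n, n * b n = ∑' n : ℕ, ((t : ℝ) - n) * b n := by
    simp only [sub_mul]
    rw [← tsum_mul_left, (h0.mul_left (t : ℝ)).tsum_sub h1]
  rw [htot, ← hsum.sum_add_tsum_nat_add t, sub_add_cancel_left, abs_neg, ← tsum_mul_right]
  refine tsum_of_norm_bounded (f := fun n => ((t : ℝ) - (n + t : ℕ)) * b (n + t))
    (hmaj.mul_right _).hasSum fun n => ?_
  push_cast
  rw [norm_mul, Real.norm_eq_abs, Real.norm_eq_abs, show (t : ℝ) - (n + t) = -n by ring, abs_neg,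
    Nat.abs_cast, mul_assoc, ← pow_add]
  exact mul_le_mul_of_nonneg_left (hb _) n.cast_nonneg

/-- Long-term variance of the symmetric decoherent Hadamard walk:
`Var(X_t) = ((p + 2√(1+q²) - 2)/p)·t - 2q²/(p√(1+q²)) - (2/p²)(1+q²-√(1+q²)) + O(e^{-ct})`. -/
theorem symmetric_walk_variance_asymptotics (p q : ℝ)
    (hp0 : 0 < p) (hp1 : p ≤ 1) (hq : q = 1 - p) :
    ∃ c > (0 : ℝ), ∃ C > (0 : ℝ), ∀ t : ℕ,
      |symVar p t - (((p + 2 * Real.sqrt (1 + q ^ 2) - 2) / p) * t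
          - 2 * q ^ 2 / (p * Real.sqrt (1 + q ^ 2))
          - (2 / p ^ 2) * (1 + q ^ 2 - Real.sqrt (1 + q ^ 2)))|
        ≤ C * Real.exp (-c * t) := by
  set l := 1 - p ^ 2 / 2 with hl
  have hl0 : 0 < l := by nlinarith
  have hl1 : l < 1 := by nlinarith
  have hM : 0 ≤ ∑' n : ℕ, (n : ℝ) * l ^ n := tsum_nonneg fun n => by positivity
  refine ⟨-Real.log l, neg_pos.2 (Real.log_neg hl0 hl1), 2 * ∑' n : ℕ, (n : ℝ) * l ^ n + 1,
    by positivity, fun t => ?_⟩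
  have hexp : Real.exp (- -Real.log l * t) = l ^ t := by
    rw [neg_neg, mul_comm, Real.exp_nat_mul, Real.exp_log hl0]
  have h := abs_sum_range_sub_mul_sub_le hl0 hl1 (abs_correlation_le hp0 hp1) t
  rw [tsum_correlation hp0 hp1, tsum_mul_correlation hp0 hp1, ← hq] at h
  have hs : Real.sqrt (1 + q ^ 2) ≠ 0 := (Real.sqrt_pos.2 (by positivity)).ne'
  have hvar : symVar p t - (((p + 2 * Real.sqrt (1 + q ^ 2) - 2) / p) * t
      - 2 * q ^ 2 / (p * Real.sqrt (1 + q ^ 2))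
      - (2 / p ^ 2) * (1 + q ^ 2 - Real.sqrt (1 + q ^ 2))) =
      2 * (∑ n ∈ Finset.range t, ((t : ℝ) - n) * correlation p n -
        (t * ((Real.sqrt (1 + q ^ 2) - q) / p) - (p * q ^ 2 / Real.sqrt (1 + q ^ 2) +
          (1 + q ^ 2) - Real.sqrt (1 + q ^ 2)) / p ^ 2)) := by
    have hp : p = 1 - q := by linarith
    rw [symVar_eq hp0.le hp1]
    field_simp
    rw [hp]
    ring
  rw [hvar, hexp, abs_mul, abs_two]
  have := pow_pos hl0 t
  linarith

end
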